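/- arXiv:1312.3873 — 3 statements merged into one kernel-verified Lean document; each statement's English description precedes it below -/
import Mathlib

section
/- Let T be a compact Hausdorff topological space and let A be an ℝ-subalgebra of the Banach algebra C(T, ℍ) of continuous quaternion-valued functions on T (with the supremum norm) such that A is also a two-sided ℍ-submodule (for every f ∈ A and every q ∈ ℍ the functions t ↦ q·f(t) and t ↦ f(t)·q belong to A), A separates the points of T, and A has no common zero (for every t ∈ T there exists f ∈ A with f(t) ≠ 0). Then A is dense in C(T, ℍ) with respect to the supremum norm. -/
open scoped Quaternion

/-- The quaternion with given coordinates in the standard basis. -/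
def Quaternion.ofCoords (a b c d : ℝ) : ℍ[ℝ] := ⟨a, b, c, d⟩

@[simp]
theorem Quaternion.re_ofCoords (a b c d : ℝ) : (ofCoords a b c d).re = a := rfl

@[simp]
theorem Quaternion.imI_ofCoords (a b c d : ℝ) : (ofCoords a b c d).imI = b := rfl

@[simp]
theorem Quaternion.imJ_ofCoords (a b c d : ℝ) : (ofCoords a b c d).imJ = c := rfl

@[simp]
theorem Quaternion.imK_ofCoords (a b c d : ℝ) : (ofCoords a b c d).imK = d := rfl

/-- The real part of a quaternion, as an average of its conjugates by the standard basis. -/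
theorem Quaternion.coe_re_eq_average (q : ℍ[ℝ]) :
    ((q.re : ℝ) : ℍ[ℝ]) = (1 / 4 : ℝ) • (q - ofCoords 0 1 0 0 * q * ofCoords 0 1 0 0
      - ofCoords 0 0 1 0 * q * ofCoords 0 0 1 0 - ofCoords 0 0 0 1 * q * ofCoords 0 0 0 1) := by
  ext <;> simp <;> ring

/-- A quaternion is the combination of the standard basis with its coordinates. -/
theorem Quaternion.eq_sum_basis_mul_coe (q : ℍ[ℝ]) :
    q = (q.re : ℍ[ℝ]) + ofCoords 0 1 0 0 * (q.imI : ℍ[ℝ]) + ofCoords 0 0 1 0 * (q.imJ : ℍ[ℝ])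
      + ofCoords 0 0 0 1 * (q.imK : ℍ[ℝ]) := by
  ext <;> simp

/-- The inclusion of real-valued into quaternion-valued continuous functions. -/
noncomputable def ContinuousMap.realToQuaternion (T : Type*) [TopologicalSpace T] :
    C(T, ℝ) →ₐ[ℝ] C(T, ℍ[ℝ]) :=
  (Algebra.ofId ℝ ℍ[ℝ]).compLeftContinuous ℝ Quaternion.continuous_coe

theorem ContinuousMap.continuous_realToQuaternion (T : Type*) [TopologicalSpace T] :
    Continuous (realToQuaternion T) :=
  ContinuousMap.continuous_postcomp ⟨_, Quaternion.continuous_coe⟩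

/-- The real part of a continuous quaternion-valued function. -/
noncomputable def ContinuousMap.quaternionRe {T : Type*} [TopologicalSpace T]
    (f : C(T, ℍ[ℝ])) : C(T, ℝ) :=
  ⟨fun t => (f t).re, Quaternion.continuous_re.comp f.continuous⟩

theorem ContinuousMap.realToQuaternion_quaternionRe_mem
    {T : Type*} [TopologicalSpace T] (A : Subalgebra ℝ C(T, ℍ[ℝ]))
    (hleft : ∀ f ∈ A, ∀ q : ℍ[ℝ], (ContinuousMap.const T q) * f ∈ A)
    (hright : ∀ f ∈ A, ∀ q : ℍ[ℝ], f * (ContinuousMap.const T q) ∈ A)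
    {f : C(T, ℍ[ℝ])} (hf : f ∈ A) : realToQuaternion T f.quaternionRe ∈ A := by
  have h (q : ℍ[ℝ]) : const T q * f * const T q ∈ A := hright _ (hleft _ hf q) q
  convert A.smul_mem (A.sub_mem (A.sub_mem (A.sub_mem hf (h (Quaternion.ofCoords 0 1 0 0)))
    (h (Quaternion.ofCoords 0 0 1 0)))
    (h (Quaternion.ofCoords 0 0 0 1))) (1 / 4 : ℝ) using 1
  exact ContinuousMap.ext fun t => Quaternion.coe_re_eq_average (f t)

/-- Quaternion analog of the Stone–Weierstrass theorem: an ℝ-subalgebra of `C(T, ℍ)`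
which is a two-sided ℍ-submodule, separates points, and has no common zero, is dense. -/
theorem quaternion_stone_weierstrass
    {T : Type*} [TopologicalSpace T] [CompactSpace T] [T2Space T]
    (A : Subalgebra ℝ C(T, ℍ[ℝ]))
    (hleft : ∀ f ∈ A, ∀ q : ℍ[ℝ], (ContinuousMap.const T q) * f ∈ A)
    (hright : ∀ f ∈ A, ∀ q : ℍ[ℝ], f * (ContinuousMap.const T q) ∈ A)
    (hsep : ∀ x y : T, x ≠ y → ∃ f ∈ A, f x ≠ f y)
    (hnozero : ∀ t : T, ∃ f ∈ A, f t ≠ 0) :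
    Dense (A : Set C(T, ℍ[ℝ])) := by
  have hS : (A.comap (ContinuousMap.realToQuaternion T)).SeparatesPoints := by
    intro x y hxy
    obtain ⟨f, hf, hne⟩ := hsep x y hxy
    refine ⟨_, ⟨_, ContinuousMap.realToQuaternion_quaternionRe_mem A hleft hright
      (hleft f hf (star (f x - f y))), rfl⟩, fun h => hne ?_⟩
    have h' : (star (f x - f y) * f x).re = (star (f x - f y) * f y).re := h
    rw [← sub_eq_zero, ← Quaternion.re_sub, ← mul_sub, Quaternion.star_mul_self,
      Quaternion.re_coe, Quaternion.normSq_eq_zero] at h'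
    exact sub_eq_zero.mp h'
  have hreal (g : C(T, ℝ)) : ContinuousMap.realToQuaternion T g ∈ A.topologicalClosure :=
    map_mem_closure (ContinuousMap.continuous_realToQuaternion T)
      (ContinuousMap.continuousMap_mem_subalgebra_closure_of_separatesPoints _ hS g)
      fun _ h => h
  have hconst (q : ℍ[ℝ]) : ContinuousMap.const T q ∈ A.topologicalClosure :=
    A.le_topologicalClosure (by simpa using hleft 1 A.one_mem q)
  intro f
  change f ∈ A.topologicalClosure
  have hmem (q : ℍ[ℝ]) (g : C(T, ℝ)) :
      ContinuousMap.const T q * ContinuousMap.realToQuaternion T g ∈ A.topologicalClosure :=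
    mul_mem (hconst q) (hreal g)
  convert add_mem (add_mem (add_mem (hreal f.quaternionRe)
    (hmem (Quaternion.ofCoords 0 1 0 0)
      ⟨fun t => (f t).imI, Quaternion.continuous_imI.comp f.continuous⟩))
    (hmem (Quaternion.ofCoords 0 0 1 0)
      ⟨fun t => (f t).imJ, Quaternion.continuous_imJ.comp f.continuous⟩))
    (hmem (Quaternion.ofCoords 0 0 0 1)
      ⟨fun t => (f t).imK, Quaternion.continuous_imK.comp f.continuous⟩)
    using 1
  exact ContinuousMap.ext fun t => Quaternion.eq_sum_basis_mul_coe (f t)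
end

section
/- Let U be a nonempty compact subset of ℍ that is canonically closed, i.e. U equals the closure of its interior. Then the set 𝒫(U, ℍ) of all quaternion polynomial functions on U — the smallest ℝ-subalgebra of C(U, ℍ) containing all constant functions with values in ℍ and the identity function z ↦ z (equivalently, all finite sums of monomials of the form a₀ z a₁ z ⋯ a_{m−1} z a_m with quaternion coefficients a₀, …, a_m) — is dense in C(U, ℍ) with respect to the supremum norm. -/
open scoped Quaternion

/-- The imaginary unit `i` of the real quaternions. -/
@[simps]
def quaternionUnitI : ℍ[ℝ] := ⟨0, 1, 0, 0⟩

/-- The imaginary unit `j` of the real quaternions. -/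
@[simps]
def quaternionUnitJ : ℍ[ℝ] := ⟨0, 0, 1, 0⟩

/-- The imaginary unit `k` of the real quaternions. -/
@[simps]
def quaternionUnitK : ℍ[ℝ] := ⟨0, 0, 0, 1⟩

/-- The real part of a quaternion as a two-sided linear polynomial. -/
theorem quaternion_coe_re_eq (q : ℍ[ℝ]) :
    ((q.re : ℝ) : ℍ[ℝ]) = (1 / 4 : ℝ) • (q - quaternionUnitI * q * quaternionUnitI -
      quaternionUnitJ * q * quaternionUnitJ - quaternionUnitK * q * quaternionUnitK) := by
  ext <;> simp <;> ring

theorem quaternion_eq_coe_components (q : ℍ[ℝ]) :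
    q = ((q.re : ℝ) : ℍ[ℝ]) + ((q.imI : ℝ) : ℍ[ℝ]) * quaternionUnitI +
      ((q.imJ : ℝ) : ℍ[ℝ]) * quaternionUnitJ + ((q.imK : ℝ) : ℍ[ℝ]) * quaternionUnitK := by
  ext <;> simp

/-- Postcomposition with the inclusion of the reals into the quaternions. -/
noncomputable def quaternionCoeLeft (X : Type*) [TopologicalSpace X] :
    C(X, ℝ) →ₐ[ℝ] C(X, ℍ[ℝ]) :=
  (Algebra.ofId ℝ ℍ[ℝ]).compLeftContinuous ℝ Quaternion.continuous_coe

/-- A subalgebra of quaternion-valued functions which contains the constants and separates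
points is dense. -/
theorem quaternion_subalgebra_dense {X : Type*} [TopologicalSpace X] [CompactSpace X]
    (A : Subalgebra ℝ C(X, ℍ[ℝ])) (hconst : ∀ q, ContinuousMap.const X q ∈ A)
    (hsep : A.SeparatesPoints) : Dense (A : Set C(X, ℍ[ℝ])) := by
  have hre : ∀ f ∈ A, quaternionCoeLeft X ⟨fun x => (f x).re,
      Quaternion.continuous_re.comp f.continuous⟩ ∈ A := by
    intro f hf
    have hmul := fun q => A.mul_mem (A.mul_mem (hconst q) hf) (hconst q)
    convert A.smul_mem (A.sub_mem (A.sub_mem (A.sub_mem hf (hmul quaternionUnitI))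
      (hmul quaternionUnitJ)) (hmul quaternionUnitK)) (1 / 4 : ℝ) using 1
    exact ContinuousMap.ext fun x => quaternion_coe_re_eq (f x)
  have htop : (A.comap (quaternionCoeLeft X)).topologicalClosure = ⊤ := by
    refine ContinuousMap.subalgebra_topologicalClosure_eq_top_of_separatesPoints _ ?_
    intro x y hxy
    obtain ⟨_, ⟨f, hf, rfl⟩, hne⟩ := hsep hxy
    by_contra! h
    have key : ∀ q : ℍ[ℝ], (q * f x).re = (q * f y).re := fun q =>
      h _ ⟨_, hre _ (A.mul_mem (hconst q) hf), rfl⟩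
    refine hne (Quaternion.ext (a := f x) (b := f y) ?_ ?_ ?_ ?_)
    · simpa using key 1
    · simpa using key quaternionUnitI
    · simpa using key quaternionUnitJ
    · simpa using key quaternionUnitK
  have hcont : Continuous (quaternionCoeLeft X) :=
    ContinuousMap.continuous_postcomp ⟨_, Quaternion.continuous_coe⟩
  have hcoe : ∀ g : C(X, ℝ), quaternionCoeLeft X g ∈ A.topologicalClosure := by
    intro g
    have hg : g ∈ (A.comap (quaternionCoeLeft X)).topologicalClosure := htop ▸ Algebra.mem_top
    exact map_mem_closure hcont hg fun _ h => h
  intro f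
  have hmem := fun (g : C(X, ℝ)) (q : ℍ[ℝ]) =>
    A.topologicalClosure.mul_mem (hcoe g) (A.le_topologicalClosure (hconst q))
  change f ∈ A.topologicalClosure
  convert add_mem (add_mem (add_mem
    (hcoe ⟨_, Quaternion.continuous_re.comp f.continuous⟩)
    (hmem ⟨_, Quaternion.continuous_imI.comp f.continuous⟩ quaternionUnitI))
    (hmem ⟨_, Quaternion.continuous_imJ.comp f.continuous⟩ quaternionUnitJ))
    (hmem ⟨_, Quaternion.continuous_imK.comp f.continuous⟩ quaternionUnitK) using 1
  exact ContinuousMap.ext fun x => quaternion_eq_coe_components (f x)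

/-- On a nonempty compact canonically closed subset `U` of the quaternions, the
ℝ-subalgebra of `C(U, ℍ)` generated by the quaternion constants and the identity
function (i.e. all quaternion polynomial functions) is dense in `C(U, ℍ)`. -/
theorem quaternion_polynomials_dense
    (U : Set ℍ[ℝ]) (hne : U.Nonempty) (hcomp : IsCompact U)
    (hcan : U = closure (interior U)) :
    Dense ((Algebra.adjoin ℝ
        (({⟨fun z => (z : ℍ[ℝ]), continuous_subtype_val⟩} ∪
          Set.range fun q : ℍ[ℝ] => ContinuousMap.const U q) :
          Set C(U, ℍ[ℝ])) : Subalgebra ℝ C(U, ℍ[ℝ])) : Set C(U, ℍ[ℝ])) := by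
  have : CompactSpace U := isCompact_iff_compactSpace.mp hcomp
  refine quaternion_subalgebra_dense _
    (fun q => Algebra.subset_adjoin (Or.inr ⟨q, rfl⟩)) fun x y hxy => ?_
  exact ⟨_, ⟨_, Algebra.subset_adjoin (Or.inl rfl), rfl⟩, fun h => hxy (Subtype.ext h)⟩
end

section
/- Let f : B → ℍ be harmonic on the open unit ball B of ℍ with f(0) = 0 and |f(z)| ≤ 1 for all z ∈ B. Then |f(z)| ≤ U(|z|·1) for every z ∈ B, where |z|·1 denotes the real quaternion (|z|, 0, 0, 0) and U : B → ℝ is the Poisson integral U(x) = ∫_{S³} s(ξ) P(x, ξ) ψ(dξ) of the function s on S³ defined by s(ξ) = 1 if ξ₀ > 0, s(ξ) = −1 if ξ₀ < 0, and s(ξ) = 0 if ξ₀ = 0 (ξ₀ being the real part of ξ). -/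
open MeasureTheory Metric
open scoped Quaternion

noncomputable instance : MeasurableSpace ℍ[ℝ] := borel _
instance : BorelSpace ℍ[ℝ] := ⟨rfl⟩

/-- The standard basis `1, i₁, i₂, i₃` of the quaternions over ℝ. -/
noncomputable def qe : Fin 4 → ℍ[ℝ]
  | 0 => ⟨1, 0, 0, 0⟩
  | 1 => ⟨0, 1, 0, 0⟩
  | 2 => ⟨0, 0, 1, 0⟩
  | 3 => ⟨0, 0, 0, 1⟩

/-- The Dirac operator `σf(z) = ∑ⱼ (∂f/∂zⱼ)(z)·iⱼ` (with `i₀ = 1`), where `∂/∂zⱼ` is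
the partial derivative in the `j`-th real coordinate direction of `ℍ ≅ ℝ⁴`. -/
noncomputable def Dirac (f : ℍ[ℝ] → ℍ[ℝ]) (z : ℍ[ℝ]) : ℍ[ℝ] :=
  ∑ j : Fin 4, fderiv ℝ f z (qe j) * qe j

/-- The adjoint Dirac operator `σ*f(z) = ∑ⱼ (∂f/∂zⱼ)(z)·iⱼ*`. -/
noncomputable def DiracStar (f : ℍ[ℝ] → ℍ[ℝ]) (z : ℍ[ℝ]) : ℍ[ℝ] :=
  ∑ j : Fin 4, fderiv ℝ f z (qe j) * star (qe j)

/-- The Laplace operator `Δf(z) = ∑ⱼ ∂²f/∂zⱼ²(z)` in the four real coordinates of `ℍ ≅ ℝ⁴`. -/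
noncomputable def qLap (f : ℍ[ℝ] → ℍ[ℝ]) (z : ℍ[ℝ]) : ℍ[ℝ] :=
  ∑ j : Fin 4, fderiv ℝ (fun w => fderiv ℝ f w (qe j)) z (qe j)

/-- The Poisson kernel `P(z, ξ) = (1 − |z|²)/|z − ξ|⁴` of the unit ball of `ℍ ≅ ℝ⁴`. -/
noncomputable def pker (z ξ : ℍ[ℝ]) : ℝ := (1 - ‖z‖ ^ 2) / ‖z - ξ‖ ^ 4

/-- The sign of the real part: `1` if `ξ₀ > 0`, `−1` if `ξ₀ < 0`, `0` if `ξ₀ = 0`. -/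
noncomputable def bdrySign (ξ : ℍ[ℝ]) : ℝ := Real.sign ξ.re

/-- The Poisson integral `U(x) = ∫_{S³} s(ξ) P(x, ξ) ψ(dξ)` of the sign function. -/
noncomputable def Upois (ψ : Measure ℍ[ℝ]) (x : ℍ[ℝ]) : ℝ :=
  ∫ ξ, bdrySign ξ * pker x ξ ∂ψ

theorem ae_mem_sphere {ψ : Measure ℍ[ℝ]} (hψsupp : ψ (sphere (0 : ℍ[ℝ]) 1)ᶜ = 0) :
    ∀ᵐ ξ ∂ψ, ξ ∈ sphere (0 : ℍ[ℝ]) 1 :=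
  mem_ae_iff.2 hψsupp

theorem restrict_sphere {ψ : Measure ℍ[ℝ]} (hS : ∀ᵐ ξ ∂ψ, ξ ∈ sphere (0 : ℍ[ℝ]) 1) :
    ψ.restrict (sphere 0 1) = ψ :=
  Measure.restrict_eq_self_of_ae_mem hS

theorem integrable_of_continuousOn_sphere {ψ : Measure ℍ[ℝ]} [IsProbabilityMeasure ψ]
    (hS : ∀ᵐ ξ ∂ψ, ξ ∈ sphere (0 : ℍ[ℝ]) 1) {φ : ℍ[ℝ] → ℝ}
    (hφ : ContinuousOn φ (sphere 0 1)) : Integrable φ ψ := by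
  have h := hφ.integrableOn_compact (μ := ψ) (isCompact_sphere 0 1)
  rwa [IntegrableOn, restrict_sphere hS] at h

/-- Differentiation under the integral sign over the unit sphere. -/
theorem hasDerivAt_integral_sphere {ψ : Measure ℍ[ℝ]} [IsProbabilityMeasure ψ]
    (hS : ∀ᵐ ξ ∂ψ, ξ ∈ sphere (0 : ℍ[ℝ]) 1) {F F' : ℝ → ℍ[ℝ] → ℝ} {I : Set ℝ} (hI : IsOpen I)
    (hFc : ∀ s ∈ I, ContinuousOn (F s) (sphere 0 1))
    (hF : ∀ s ∈ I, ∀ ξ ∈ sphere (0 : ℍ[ℝ]) 1, HasDerivAt (F · ξ) (F' s ξ) s)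
    (hF' : ContinuousOn (Function.uncurry F') (I ×ˢ sphere 0 1)) {s : ℝ} (hs : s ∈ I) :
    HasDerivAt (fun s => ∫ ξ, F s ξ ∂ψ) (∫ ξ, F' s ξ ∂ψ) s := by
  obtain ⟨ε, hε, hεI⟩ := Metric.nhds_basis_closedBall.mem_iff.1 (hI.mem_nhds hs)
  obtain ⟨C, hC⟩ := ((isCompact_closedBall s ε).prod
    (isCompact_sphere (0 : ℍ[ℝ]) 1)).exists_bound_of_continuousOn
    (hF'.mono (Set.prod_mono hεI le_rfl))
  have hF's : ContinuousOn (F' s) (sphere 0 1) :=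
    hF'.comp (f := fun ξ => (s, ξ)) (by fun_prop) fun ξ hξ => ⟨hs, hξ⟩
  refine (hasDerivAt_integral_of_dominated_loc_of_deriv_le (F := F) (F' := F')
    (bound := fun _ => C) (closedBall_mem_nhds s hε) ?_
    (integrable_of_continuousOn_sphere hS (hFc s hs))
    (integrable_of_continuousOn_sphere hS hF's).aestronglyMeasurable ?_
    (integrable_const C) ?_).2
  · filter_upwards [hI.mem_nhds hs] with x hx
    exact (integrable_of_continuousOn_sphere hS (hFc x hx)).aestronglyMeasurable
  · filter_upwards [hS] with ξ hξ x hx using hC (x, ξ) ⟨hx, hξ⟩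
  · filter_upwards [hS] with ξ hξ x hx using hF x (hεI hx) ξ hξ

theorem hasDerivAt_fderiv_apply_curve {E : Type*} [NormedAddCommGroup E] [NormedSpace ℝ E]
    {g : E → ℝ} {c c' : ℝ → E} {v : E} {s : ℝ} (hg : DifferentiableAt ℝ (fderiv ℝ g) (c s))
    (hc : HasDerivAt c (c' s) s) (hc' : HasDerivAt c' v s) :
    HasDerivAt (fun s => fderiv ℝ g (c s) (c' s))
      (fderiv ℝ (fderiv ℝ g) (c s) (c' s) (c' s) + fderiv ℝ g (c s) v) s := by
  have hd : HasDerivAt (fun s => fderiv ℝ g (c s)) (fderiv ℝ (fderiv ℝ g) (c s) (c' s)) s :=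
    hg.hasFDerivAt.comp_hasDerivAt s hc
  exact hd.clm_apply hc'

/-- First and second derivatives of the average of `g` over a moving family of points
`c s ξ`, `ξ` in the unit sphere. -/
theorem hasDerivAt_integral_comp_curve {ψ : Measure ℍ[ℝ]} [IsProbabilityMeasure ψ]
    (hS : ∀ᵐ ξ ∂ψ, ξ ∈ sphere (0 : ℍ[ℝ]) 1) {g : ℍ[ℝ] → ℝ} {Ω : Set ℍ[ℝ]} (hΩ : IsOpen Ω)
    (hg : ContDiffOn ℝ 2 g Ω) {c c' c'' : ℝ → ℍ[ℝ] → ℍ[ℝ]} {I : Set ℝ} (hI : IsOpen I)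
    (hcΩ : ∀ s ∈ I, ∀ ξ ∈ sphere (0 : ℍ[ℝ]) 1, c s ξ ∈ Ω)
    (hc : ∀ s ξ, HasDerivAt (c · ξ) (c' s ξ) s) (hc' : ∀ s ξ, HasDerivAt (c' · ξ) (c'' s ξ) s)
    (hcc : Continuous (Function.uncurry c)) (hcc' : Continuous (Function.uncurry c'))
    (hcc'' : Continuous (Function.uncurry c'')) {s : ℝ} (hs : s ∈ I) :
    HasDerivAt (fun s => ∫ ξ, g (c s ξ) ∂ψ) (∫ ξ, fderiv ℝ g (c s ξ) (c' s ξ) ∂ψ) s ∧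
    HasDerivAt (fun s => ∫ ξ, fderiv ℝ g (c s ξ) (c' s ξ) ∂ψ)
      (∫ ξ, (fderiv ℝ (fderiv ℝ g) (c s ξ) (c' s ξ) (c' s ξ)
        + fderiv ℝ g (c s ξ) (c'' s ξ)) ∂ψ) s := by
  have hg1 : ContDiffOn ℝ 1 (fderiv ℝ g) Ω := hg.fderiv_of_isOpen hΩ (by norm_num)
  have hg2 : ContinuousOn (fderiv ℝ (fderiv ℝ g)) Ω :=
    hg1.continuousOn_fderiv_of_isOpen hΩ (by norm_num)
  have hmap : Set.MapsTo (Function.uncurry c) (I ×ˢ sphere 0 1) Ω :=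
    fun p hp => hcΩ p.1 hp.1 p.2 hp.2
  have h0 := hg.continuousOn.comp hcc.continuousOn hmap
  have h1 : ContinuousOn (fun p : ℝ × ℍ[ℝ] => fderiv ℝ g (c p.1 p.2)) (I ×ˢ sphere 0 1) :=
    hg1.continuousOn.comp hcc.continuousOn hmap
  have h2 : ContinuousOn (fun p : ℝ × ℍ[ℝ] => fderiv ℝ (fderiv ℝ g) (c p.1 p.2))
      (I ×ˢ sphere 0 1) := hg2.comp hcc.continuousOn hmap
  have h1' : ContinuousOn (fun p : ℝ × ℍ[ℝ] => c' p.1 p.2) (I ×ˢ sphere 0 1) :=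
    hcc'.continuousOn
  have h2' : ContinuousOn (fun p : ℝ × ℍ[ℝ] => c'' p.1 p.2) (I ×ˢ sphere 0 1) :=
    hcc''.continuousOn
  have hslice : ∀ s ∈ I, Set.MapsTo (fun ξ : ℍ[ℝ] => (s, ξ)) (sphere 0 1) (I ×ˢ sphere 0 1) :=
    fun s hs ξ hξ => ⟨hs, hξ⟩
  have hD : ContinuousOn (Function.uncurry fun s ξ => fderiv ℝ g (c s ξ) (c' s ξ))
      (I ×ˢ sphere 0 1) := h1.clm_apply h1'
  have hgd : ∀ x ∈ Ω, HasFDerivAt g (fderiv ℝ g x) x := fun x hx =>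
    ((hg.contDiffAt (hΩ.mem_nhds hx)).differentiableAt (by norm_num)).hasFDerivAt
  have hgd2 : ∀ x ∈ Ω, DifferentiableAt ℝ (fderiv ℝ g) x := fun x hx =>
    (hg1.contDiffAt (hΩ.mem_nhds hx)).differentiableAt (by norm_num)
  constructor
  · refine hasDerivAt_integral_sphere hS hI (F := fun s ξ => g (c s ξ))
      (F' := fun s ξ => fderiv ℝ g (c s ξ) (c' s ξ)) ?_ ?_ hD hs
    · exact fun s hs => h0.comp (by fun_prop) (hslice s hs)
    · exact fun s hs ξ hξ => (hgd _ (hcΩ s hs ξ hξ)).comp_hasDerivAt s (hc s ξ)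
  · refine hasDerivAt_integral_sphere hS hI (F := fun s ξ => fderiv ℝ g (c s ξ) (c' s ξ))
      (F' := fun s ξ => fderiv ℝ (fderiv ℝ g) (c s ξ) (c' s ξ) (c' s ξ)
        + fderiv ℝ g (c s ξ) (c'' s ξ)) ?_ ?_ ?_ hs
    · exact fun s hs => hD.comp (by fun_prop) (hslice s hs)
    · intro s hs ξ hξ
      exact hasDerivAt_fderiv_apply_curve (hgd2 _ (hcΩ s hs ξ hξ)) (hc s ξ) (hc' s ξ)
    · exact ((h2.clm_apply h1').clm_apply h1').add (h1.clm_apply h2')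

/-- Left multiplication by a unit quaternion, as a linear isometry. -/
noncomputable def mulLeftIsometry (u : ℍ[ℝ]) (hu : ‖u‖ = 1) : ℍ[ℝ] ≃ₗᵢ[ℝ] ℍ[ℝ] :=
  LinearIsometry.toLinearIsometryEquiv
    { LinearMap.mulLeft ℝ u with norm_map' := fun x => by simp [hu] } rfl

@[simp] theorem mulLeftIsometry_apply (u : ℍ[ℝ]) (hu : ‖u‖ = 1) (x : ℍ[ℝ]) :
    mulLeftIsometry u hu x = u * x := rfl

theorem integral_comp_isometry {ψ : Measure ℍ[ℝ]}
    (hψrot : ∀ T : ℍ[ℝ] ≃ₗᵢ[ℝ] ℍ[ℝ], ψ.map T = ψ) (T : ℍ[ℝ] ≃ₗᵢ[ℝ] ℍ[ℝ]) (φ : ℍ[ℝ] → ℝ) :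
    ∫ ξ, φ (T ξ) ∂ψ = ∫ ξ, φ ξ ∂ψ := by
  conv_rhs => rw [← hψrot T]
  exact (T.toHomeomorph.measurableEmbedding.integral_map φ).symm

theorem norm_sq_eq_coords (x : ℍ[ℝ]) :
    ‖x‖ ^ 2 = x.re ^ 2 + x.imI ^ 2 + x.imJ ^ 2 + x.imK ^ 2 := by
  rw [sq, ← Quaternion.normSq_eq_norm_mul_self, Quaternion.normSq_def']

theorem inner_eq_coords (x y : ℍ[ℝ]) :
    inner ℝ x y = x.re * y.re + x.imI * y.imI + x.imJ * y.imJ + x.imK * y.imK := by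
  rw [Quaternion.inner_def]
  simp

theorem orthonormal_qe_mul {ξ : ℍ[ℝ]} (hξ : ‖ξ‖ = 1) :
    Orthonormal ℝ fun k => qe k * ξ := by
  have h := norm_sq_eq_coords ξ
  rw [hξ] at h
  rw [orthonormal_iff_ite]
  intro i j
  simp only [inner_eq_coords, Quaternion.re_mul, Quaternion.imI_mul, Quaternion.imJ_mul,
    Quaternion.imK_mul]
  fin_cases i <;> fin_cases j <;> simp [qe] <;> linarith

/-- The orthonormal basis `ξ, i₁ξ, i₂ξ, i₃ξ` attached to a unit quaternion `ξ`. -/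
noncomputable def rotatedBasis (ξ : ℍ[ℝ]) (hξ : ‖ξ‖ = 1) : OrthonormalBasis (Fin 4) ℝ ℍ[ℝ] :=
  (basisOfOrthonormalOfCardEqFinrank (orthonormal_qe_mul hξ)
    (by simp [Quaternion.finrank_eq_four])).toOrthonormalBasis (by
      simpa using orthonormal_qe_mul hξ)

theorem rotatedBasis_apply (ξ : ℍ[ℝ]) (hξ : ‖ξ‖ = 1) (k : Fin 4) :
    rotatedBasis ξ hξ k = qe k * ξ := by
  simp [rotatedBasis]

theorem laplacian_eq_sum_rotated (g : ℍ[ℝ] → ℝ) (x : ℍ[ℝ]) {ξ : ℍ[ℝ]} (hξ : ‖ξ‖ = 1) :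
    Laplacian.laplacian g x = ∑ k, fderiv ℝ (fderiv ℝ g) x (qe k * ξ) (qe k * ξ) := by
  rw [InnerProductSpace.laplacian_eq_iteratedFDeriv_orthonormalBasis g (rotatedBasis ξ hξ)]
  simp [iteratedFDeriv_two_apply, rotatedBasis_apply]

theorem add_smul_mem_ball {a ξ : ℍ[ℝ]} {t : ℝ} (hat : ‖a‖ + |t| < 1)
    (hξ : ξ ∈ sphere (0 : ℍ[ℝ]) 1) : a + t • ξ ∈ ball (0 : ℍ[ℝ]) 1 := by
  rw [mem_sphere_zero_iff_norm] at hξ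
  rw [mem_ball_zero_iff]
  calc ‖a + t • ξ‖ ≤ ‖a‖ + ‖t • ξ‖ := norm_add_le _ _
    _ = ‖a‖ + |t| := by rw [norm_smul, hξ, mul_one, Real.norm_eq_abs]
    _ < 1 := hat

theorem norm_rotation {k : Fin 4} (hk : k ≠ 0) (θ : ℝ) :
    ‖(Real.cos θ • 1 + Real.sin θ • qe k : ℍ[ℝ])‖ = 1 := by
  rw [← sq_eq_sq₀ (norm_nonneg _) zero_le_one, norm_sq_eq_coords]
  simp only [Quaternion.re_add, Quaternion.imI_add, Quaternion.imJ_add, Quaternion.imK_add,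
    Quaternion.re_smul, Quaternion.imI_smul, Quaternion.imJ_smul, Quaternion.imK_smul]
  have h := Real.cos_sq_add_sin_sq θ
  fin_cases k <;> simp_all [qe]

theorem integral_second_rotational_derivative {ψ : Measure ℍ[ℝ]} [IsProbabilityMeasure ψ]
    (hS : ∀ᵐ ξ ∂ψ, ξ ∈ sphere (0 : ℍ[ℝ]) 1)
    (hψrot : ∀ T : ℍ[ℝ] ≃ₗᵢ[ℝ] ℍ[ℝ], ψ.map T = ψ) {g : ℍ[ℝ] → ℝ}
    (hg : ContDiffOn ℝ 2 g (ball 0 1)) {a : ℍ[ℝ]} {t : ℝ} (hat : ‖a‖ + |t| < 1)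
    {k : Fin 4} (hk : k ≠ 0) :
    ∫ ξ, (fderiv ℝ (fderiv ℝ g) (a + t • ξ) (t • (qe k * ξ)) (t • (qe k * ξ))
      + fderiv ℝ g (a + t • ξ) (-(t • ξ))) ∂ψ = 0 := by
  have hmul : ∀ (θ : ℝ) (ξ : ℍ[ℝ]), Real.cos θ • ξ + Real.sin θ • (qe k * ξ)
      = mulLeftIsometry _ (norm_rotation hk θ) ξ := fun θ ξ => by simp [add_mul]
  have key := fun θ => hasDerivAt_integral_comp_curve hS isOpen_ball hg
    (c := fun θ ξ => a + t • (Real.cos θ • ξ + Real.sin θ • (qe k * ξ)))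
    (c' := fun θ ξ => t • (-Real.sin θ • ξ + Real.cos θ • (qe k * ξ)))
    (c'' := fun θ ξ => t • (-Real.cos θ • ξ + -Real.sin θ • (qe k * ξ)))
    isOpen_univ
    (fun θ _ ξ hξ => add_smul_mem_ball hat (by
      rw [hmul, mem_sphere_zero_iff_norm, LinearIsometryEquiv.norm_map]
      simpa using hξ))
    (fun θ ξ => ((((Real.hasDerivAt_cos θ).smul_const ξ).add
      ((Real.hasDerivAt_sin θ).smul_const (qe k * ξ))).const_smul t).const_add a)
    (fun θ ξ => (((Real.hasDerivAt_sin θ).neg.smul_const ξ).add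
      ((Real.hasDerivAt_cos θ).smul_const (qe k * ξ))).const_smul t)
    (by fun_prop) (by fun_prop) (by fun_prop) (Set.mem_univ θ)
  have hconst : ∀ θ : ℝ, ∫ ξ, g (a + t • (Real.cos θ • ξ + Real.sin θ • (qe k * ξ))) ∂ψ
      = ∫ ξ, g (a + t • ξ) ∂ψ := fun θ => by
    simp_rw [hmul]
    exact integral_comp_isometry hψrot _ fun ξ => g (a + t • ξ)
  have h1 : ∀ θ : ℝ, ∫ ξ, fderiv ℝ g (a + t • (Real.cos θ • ξ + Real.sin θ • (qe k * ξ)))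
      (t • (-Real.sin θ • ξ + Real.cos θ • (qe k * ξ))) ∂ψ = 0 := fun θ => by
    have h := (key θ).1
    simp_rw [hconst] at h
    exact h.unique (hasDerivAt_const _ _)
  have h2 := (key 0).2
  simp_rw [h1] at h2
  simpa using h2.unique (hasDerivAt_const _ _)

theorem integral_eq_zero_of_odd {ψ : Measure ℍ[ℝ]}
    (hψrot : ∀ T : ℍ[ℝ] ≃ₗᵢ[ℝ] ℍ[ℝ], ψ.map T = ψ) (φ : ℍ[ℝ] → ℝ) (hφ : ∀ ξ, φ (-ξ) = -φ ξ) :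
    ∫ ξ, φ ξ ∂ψ = 0 := by
  have h := integral_comp_isometry hψrot (LinearIsometryEquiv.neg ℝ) φ
  simp only [LinearIsometryEquiv.coe_neg, hφ, integral_neg] at h
  linarith

/-- The spherical mean of `g` of radius `t` around `a` satisfies Euler's equation
`t φ'' + 3 φ' = 0` when `g` is harmonic. -/
theorem integral_radial_identity {ψ : Measure ℍ[ℝ]} [IsProbabilityMeasure ψ]
    (hS : ∀ᵐ ξ ∂ψ, ξ ∈ sphere (0 : ℍ[ℝ]) 1)
    (hψrot : ∀ T : ℍ[ℝ] ≃ₗᵢ[ℝ] ℍ[ℝ], ψ.map T = ψ) {g : ℍ[ℝ] → ℝ}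
    (hg : ContDiffOn ℝ 2 g (ball 0 1))
    (hΔ : ∀ x ∈ ball (0 : ℍ[ℝ]) 1, Laplacian.laplacian g x = 0) {a : ℍ[ℝ]} {t : ℝ}
    (hat : ‖a‖ + |t| < 1) :
    t ^ 2 * ∫ ξ, fderiv ℝ (fderiv ℝ g) (a + t • ξ) ξ ξ ∂ψ
      + 3 * t * ∫ ξ, fderiv ℝ g (a + t • ξ) ξ ∂ψ = 0 := by
  have hg1 : ContDiffOn ℝ 1 (fderiv ℝ g) (ball 0 1) :=
    hg.fderiv_of_isOpen isOpen_ball (by norm_num)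
  have hg2 : ContinuousOn (fderiv ℝ (fderiv ℝ g)) (ball 0 1) :=
    hg1.continuousOn_fderiv_of_isOpen isOpen_ball (by norm_num)
  have hmap : Set.MapsTo (fun ξ : ℍ[ℝ] => a + t • ξ) (sphere 0 1) (ball 0 1) :=
    fun ξ hξ => add_smul_mem_ball hat hξ
  have hc : ContinuousOn (fun ξ : ℍ[ℝ] => a + t • ξ) (sphere 0 1) := by fun_prop
  have h1 : ContinuousOn (fun ξ : ℍ[ℝ] => fderiv ℝ g (a + t • ξ)) (sphere 0 1) :=
    hg1.continuousOn.comp hc hmap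
  have h2 : ContinuousOn (fun ξ : ℍ[ℝ] => fderiv ℝ (fderiv ℝ g) (a + t • ξ)) (sphere 0 1) :=
    hg2.comp hc hmap
  have i1 : ∀ w : ℍ[ℝ] → ℍ[ℝ], Continuous w →
      Integrable (fun ξ => fderiv ℝ g (a + t • ξ) (w ξ)) ψ := fun w hw =>
    integrable_of_continuousOn_sphere hS (h1.clm_apply hw.continuousOn)
  have i2 : ∀ w : ℍ[ℝ] → ℍ[ℝ], Continuous w →
      Integrable (fun ξ => fderiv ℝ (fderiv ℝ g) (a + t • ξ) (w ξ) (w ξ)) ψ := fun w hw =>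
    integrable_of_continuousOn_sphere hS
      ((h2.clm_apply hw.continuousOn).clm_apply hw.continuousOn)
  have hsum : ∫ ξ, ∑ k ∈ ({1, 2, 3} : Finset (Fin 4)),
      (fderiv ℝ (fderiv ℝ g) (a + t • ξ) (t • (qe k * ξ)) (t • (qe k * ξ))
      + fderiv ℝ g (a + t • ξ) (-(t • ξ))) ∂ψ = 0 := by
    rw [integral_finsetSum]
    · refine Finset.sum_eq_zero fun k hk => ?_
      exact integral_second_rotational_derivative hS hψrot hg hat (by rintro rfl; simp at hk)
    · intro k _
      exact (i2 _ (by fun_prop)).add (i1 _ (by fun_prop))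
  rw [← neg_eq_zero, ← hsum, ← integral_const_mul, ← integral_const_mul, ← integral_add
    ((i2 (fun ξ => ξ) continuous_id).const_mul _)
    ((i1 (fun ξ => ξ) continuous_id).const_mul _), ← integral_neg]
  refine integral_congr_ae ?_
  filter_upwards [hS] with ξ hξ
  have hL := hΔ _ (hmap hξ)
  rw [laplacian_eq_sum_rotated g _ (mem_sphere_zero_iff_norm.1 hξ), Fin.sum_univ_four] at hL
  have h0 : qe 0 * ξ = ξ := by
    rw [show qe 0 = 1 from rfl, one_mul]
  rw [h0] at hL
  simp only [map_smul, map_neg, FunLike.coe_smul, Pi.smul_apply, smul_eq_mul]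
  rw [Finset.sum_insert (by decide), Finset.sum_insert (by decide), Finset.sum_singleton]
  linear_combination -t ^ 2 * hL

/-- The mean value property of harmonic functions on the unit ball. -/
theorem spherical_mean_of_harmonic {ψ : Measure ℍ[ℝ]} [IsProbabilityMeasure ψ]
    (hS : ∀ᵐ ξ ∂ψ, ξ ∈ sphere (0 : ℍ[ℝ]) 1)
    (hψrot : ∀ T : ℍ[ℝ] ≃ₗᵢ[ℝ] ℍ[ℝ], ψ.map T = ψ) {g : ℍ[ℝ] → ℝ}
    (hg : ContDiffOn ℝ 2 g (ball 0 1))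
    (hΔ : ∀ x ∈ ball (0 : ℍ[ℝ]) 1, Laplacian.laplacian g x = 0) {a : ℍ[ℝ]} {t : ℝ}
    (hat : ‖a‖ + |t| < 1) : ∫ ξ, g (a + t • ξ) ∂ψ = g a := by
  set I : Set ℝ := ball 0 (1 - ‖a‖) with hI
  have hmem : ∀ s, s ∈ I ↔ ‖a‖ + |s| < 1 := fun s => by
    rw [hI, mem_ball_zero_iff, Real.norm_eq_abs, lt_sub_iff_add_lt, add_comm]
  have key := fun s (hs : s ∈ I) => hasDerivAt_integral_comp_curve hS isOpen_ball hg
    (c := fun s ξ => a + s • ξ) (c' := fun _ ξ => ξ) (c'' := fun _ _ => 0) isOpen_ball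
    (fun s hs ξ hξ => add_smul_mem_ball ((hmem s).1 hs) hξ)
    (fun s ξ => by simpa using ((hasDerivAt_id s).smul_const ξ).const_add a)
    (fun s ξ => hasDerivAt_const _ _) (by fun_prop) (by fun_prop) (by fun_prop) hs
  simp only [map_zero, add_zero] at key
  have hpre : IsPreconnected I := (convex_ball 0 _).isPreconnected
  have h0 : (0 : ℝ) ∈ I := by
    rw [hmem, abs_zero]; linarith [abs_nonneg t]
  have hcube : ∀ s ∈ I, HasDerivAt (fun s => s ^ 3 * ∫ ξ, fderiv ℝ g (a + s • ξ) ξ ∂ψ) 0 s := by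
    intro s hs
    refine ((hasDerivAt_pow 3 s).mul (key s hs).2).congr_deriv ?_
    have := integral_radial_identity hS hψrot hg hΔ ((hmem s).1 hs)
    push_cast
    linear_combination s * this
  have hφ' : ∀ s ∈ I, ∫ ξ, fderiv ℝ g (a + s • ξ) ξ ∂ψ = 0 := by
    intro s hs
    rcases eq_or_ne s 0 with rfl | hs0
    · exact integral_eq_zero_of_odd hψrot _ fun ξ => by simp
    · have h := isOpen_ball.is_const_of_deriv_eq_zero hpre
        (fun s hs => (hcube s hs).differentiableAt.differentiableWithinAt)
        (fun s hs => (hcube s hs).deriv) hs h0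
      simpa [hs0] using h
  have h := isOpen_ball.is_const_of_deriv_eq_zero hpre
    (fun s hs => (key s hs).1.differentiableAt.differentiableWithinAt)
    (fun s hs => (key s hs).1.deriv.trans (hφ' s hs)) ((hmem t).2 hat) h0
  simpa using h

theorem hasDerivAt_poisson_quotient {A D : ℝ → ℝ} {α β s : ℝ} (hA : HasDerivAt A (2 * α) s)
    (hD : HasDerivAt D (2 * β) s) (h0 : D s ≠ 0) :
    HasDerivAt (fun s => (1 - A s) / D s ^ 2)
      (-2 * α / D s ^ 2 - 4 * ((1 - A s) * β) / D s ^ 3) s := by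
  refine ((hA.const_sub 1).div (hD.pow 2) (pow_ne_zero 2 h0)).congr_deriv ?_
  simp only [Pi.pow_apply]
  field_simp
  ring

theorem hasDerivAt_poisson_quotient_deriv {A D α β : ℝ → ℝ} {s : ℝ}
    (hA : HasDerivAt A (2 * α s) s) (hD : HasDerivAt D (2 * β s) s) (hα : HasDerivAt α 1 s)
    (hβ : HasDerivAt β 1 s) (h0 : D s ≠ 0) :
    HasDerivAt (fun s => -2 * α s / D s ^ 2 - 4 * ((1 - A s) * β s) / D s ^ 3)
      (-2 / D s ^ 2 + 16 * (α s * β s) / D s ^ 3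
        + (1 - A s) * (24 * β s ^ 2 / D s ^ 4 - 4 / D s ^ 3)) s := by
  refine (((hα.const_mul (-2)).div (hD.pow 2) (pow_ne_zero 2 h0)).sub
    ((((hA.const_sub 1).mul hβ).const_mul 4).div (hD.pow 3) (pow_ne_zero 3 h0))).congr_deriv ?_
  simp only [Pi.pow_apply, Pi.mul_apply]
  field_simp
  ring

theorem sub_ne_zero_of_ball_sphere {z ξ : ℍ[ℝ]} (hz : z ∈ ball (0 : ℍ[ℝ]) 1)
    (hξ : ξ ∈ sphere (0 : ℍ[ℝ]) 1) : z - ξ ≠ 0 := by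
  rintro h
  rw [sub_eq_zero.1 h] at hz
  rw [mem_ball_zero_iff, mem_sphere_zero_iff_norm.1 hξ] at hz
  exact lt_irrefl _ hz

theorem pker_eq (z ξ : ℍ[ℝ]) : pker z ξ = (1 - ‖z‖ ^ 2) / (‖z - ξ‖ ^ 2) ^ 2 := by
  rw [pker, ← pow_mul]

theorem contDiffOn_pker {ξ : ℍ[ℝ]} (hξ : ξ ∈ sphere (0 : ℍ[ℝ]) 1) :
    ContDiffOn ℝ 2 (fun z => pker z ξ) (ball 0 1) := by
  simp_rw [pker_eq]
  refine ContDiffOn.div ?_ ?_ fun z hz => ?_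
  · exact (contDiff_const.sub (contDiff_norm_sq ℝ)).contDiffOn
  · exact (((contDiff_id.sub contDiff_const).norm_sq ℝ).pow 2).contDiffOn
  · exact pow_ne_zero 2 (pow_ne_zero 2 (norm_ne_zero_iff.2 (sub_ne_zero_of_ball_sphere hz hξ)))

theorem hasDerivAt_norm_sq_line (x e : ℍ[ℝ]) (s : ℝ) :
    HasDerivAt (fun s : ℝ => ‖x + s • e‖ ^ 2) (2 * inner ℝ (x + s • e) e) s := by
  have h : HasDerivAt (fun s : ℝ => x + s • e) e s := by
    simpa using ((hasDerivAt_id s).smul_const e).const_add x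
  exact h.norm_sq

theorem hasDerivAt_inner_line (x e : ℍ[ℝ]) (he : ‖e‖ = 1) (s : ℝ) :
    HasDerivAt (fun s : ℝ => inner ℝ (x + s • e) e) 1 s := by
  have h : ∀ s : ℝ, inner ℝ (x + s • e) e = inner ℝ x e + s := fun s => by
    rw [inner_add_left, real_inner_smul_left, real_inner_self_eq_norm_sq, he]; ring
  simp_rw [h]
  exact (hasDerivAt_id s).const_add _

theorem fderiv_pker {z ξ : ℍ[ℝ]} (hz : z ∈ ball (0 : ℍ[ℝ]) 1) (hξ : ξ ∈ sphere (0 : ℍ[ℝ]) 1)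
    (e : ℍ[ℝ]) : fderiv ℝ (fun z => pker z ξ) z e
      = -2 * inner ℝ z e / (‖z - ξ‖ ^ 2) ^ 2
        - 4 * ((1 - ‖z‖ ^ 2) * inner ℝ (z - ξ) e) / (‖z - ξ‖ ^ 2) ^ 3 := by
  have hd : DifferentiableAt ℝ (fun z => pker z ξ) z :=
    ((contDiffOn_pker hξ).contDiffAt (isOpen_ball.mem_nhds hz)).differentiableAt (by norm_num)
  have hc : HasDerivAt (fun s : ℝ => z + s • e) e 0 := by
    simpa using ((hasDerivAt_id (0 : ℝ)).smul_const e).const_add z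
  have h1 := hd.hasFDerivAt.comp_hasDerivAt_of_eq (0 : ℝ) hc (by simp)
  have h2 := hasDerivAt_poisson_quotient (hasDerivAt_norm_sq_line z e 0)
    (hasDerivAt_norm_sq_line (z - ξ) e 0)
    (by simpa using sub_ne_zero_of_ball_sphere hz hξ)
  have h3 : HasDerivAt (fun s : ℝ => (1 - ‖z + s • e‖ ^ 2) / (‖z - ξ + s • e‖ ^ 2) ^ 2)
      (fderiv ℝ (fun z => pker z ξ) z e) 0 := by
    refine h1.congr_of_eventuallyEq (Filter.Eventually.of_forall fun s => ?_)
    simp only [Function.comp, pker_eq, sub_add_eq_add_sub]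
  simpa using h3.unique h2

theorem fderiv_fderiv_pker {z ξ : ℍ[ℝ]} (hz : z ∈ ball (0 : ℍ[ℝ]) 1)
    (hξ : ξ ∈ sphere (0 : ℍ[ℝ]) 1) {e : ℍ[ℝ]} (he : ‖e‖ = 1) :
    fderiv ℝ (fderiv ℝ fun z => pker z ξ) z e e
      = -2 / (‖z - ξ‖ ^ 2) ^ 2 + 16 * (inner ℝ z e * inner ℝ (z - ξ) e) / (‖z - ξ‖ ^ 2) ^ 3
        + (1 - ‖z‖ ^ 2) * (24 * inner ℝ (z - ξ) e ^ 2 / (‖z - ξ‖ ^ 2) ^ 4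
          - 4 / (‖z - ξ‖ ^ 2) ^ 3) := by
  have hg1 : ContDiffOn ℝ 1 (fderiv ℝ fun z => pker z ξ) (ball 0 1) :=
    (contDiffOn_pker hξ).fderiv_of_isOpen isOpen_ball (by norm_num)
  have hd : DifferentiableAt ℝ (fderiv ℝ fun z => pker z ξ) (z + (0 : ℝ) • e) := by
    rw [zero_smul, add_zero]
    exact (hg1.contDiffAt (isOpen_ball.mem_nhds hz)).differentiableAt (by norm_num)
  have hc : HasDerivAt (fun s : ℝ => z + s • e) e 0 := by
    simpa using ((hasDerivAt_id (0 : ℝ)).smul_const e).const_add z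
  have h1 := hasDerivAt_fderiv_apply_curve (c := fun s : ℝ => z + s • e) (c' := fun _ => e) hd hc
    (hasDerivAt_const _ _)
  have h2 := hasDerivAt_poisson_quotient_deriv (hasDerivAt_norm_sq_line z e 0)
    (hasDerivAt_norm_sq_line (z - ξ) e 0) (hasDerivAt_inner_line z e he 0)
    (hasDerivAt_inner_line (z - ξ) e he 0)
    (by simpa using sub_ne_zero_of_ball_sphere hz hξ)
  have hnear : ∀ᶠ s : ℝ in nhds 0, z + s • e ∈ ball (0 : ℍ[ℝ]) 1 :=
    hc.continuousAt.eventually_mem (isOpen_ball.mem_nhds (by simpa using hz))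
  have h3 := h1.congr_of_eventuallyEq (f₁ := fun s : ℝ =>
      -2 * inner ℝ (z + s • e) e / (‖z - ξ + s • e‖ ^ 2) ^ 2
        - 4 * ((1 - ‖z + s • e‖ ^ 2) * inner ℝ (z - ξ + s • e) e) / (‖z - ξ + s • e‖ ^ 2) ^ 3) (by
    filter_upwards [hnear] with s hs
    rw [fderiv_pker hs hξ, sub_add_eq_add_sub])
  simpa using h3.unique h2

theorem laplacian_pker {z ξ : ℍ[ℝ]} (hz : z ∈ ball (0 : ℍ[ℝ]) 1)
    (hξ : ξ ∈ sphere (0 : ℍ[ℝ]) 1) : Laplacian.laplacian (fun z => pker z ξ) z = 0 := by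
  have he : ∀ k, ‖qe k‖ = 1 := fun k => by
    simpa using (orthonormal_qe_mul (ξ := 1) norm_one).1 k
  rw [laplacian_eq_sum_rotated _ z norm_one]
  simp only [mul_one, fderiv_fderiv_pker hz hξ (he _)]
  have hD := sub_ne_zero_of_ball_sphere hz hξ
  have hξ1 := norm_sq_eq_coords ξ
  rw [mem_sphere_zero_iff_norm.1 hξ] at hξ1
  have hz2 := norm_sq_eq_coords z
  have hD2 := norm_sq_eq_coords (z - ξ)
  have hD0 : ‖z - ξ‖ ^ 2 ≠ 0 := pow_ne_zero 2 (norm_ne_zero_iff.2 hD)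
  have hin : ∀ x : ℍ[ℝ], inner ℝ x (qe 0) = x.re ∧ inner ℝ x (qe 1) = x.imI ∧
      inner ℝ x (qe 2) = x.imJ ∧ inner ℝ x (qe 3) = x.imK := fun x => by
    simp only [inner_eq_coords]
    simp [qe]
  rw [Fin.sum_univ_four]
  simp only [hin, Quaternion.re_sub, Quaternion.imI_sub, Quaternion.imJ_sub,
    Quaternion.imK_sub] at hD2 ⊢
  generalize ‖z - ξ‖ ^ 2 = D at hD0 hD2 ⊢
  generalize ‖z‖ ^ 2 = A at hz2 ⊢
  have hS1 : z.re * (z.re - ξ.re) + z.imI * (z.imI - ξ.imI) + z.imJ * (z.imJ - ξ.imJ)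
      + z.imK * (z.imK - ξ.imK) = (A + D - 1) / 2 := by
    linear_combination (-1 / 2) * hz2 - (1 / 2) * hD2 + (1 / 2) * hξ1
  field_simp
  linear_combination 16 * D * hS1 - 24 * (1 - A) * hD2

theorem pker_smul_comm {ζ ξ : ℍ[ℝ]} (hζ : ‖ζ‖ = 1) (hξ : ‖ξ‖ = 1) (r : ℝ) :
    pker (r • ζ) ξ = pker (r • ξ) ζ := by
  rw [pker_eq, pker_eq, norm_smul, norm_smul, hζ, hξ, norm_sub_sq_real, norm_sub_sq_real,
    norm_smul, norm_smul, real_inner_smul_left, real_inner_smul_left, hζ, hξ,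
    real_inner_comm]

theorem pker_nonneg {z ξ : ℍ[ℝ]} (hz : z ∈ ball (0 : ℍ[ℝ]) 1) : 0 ≤ pker z ξ := by
  rw [mem_ball_zero_iff] at hz
  exact div_nonneg (sub_nonneg.2 (pow_le_one₀ (norm_nonneg z) hz.le)) (by positivity)

theorem pker_zero {ξ : ℍ[ℝ]} (hξ : ξ ∈ sphere (0 : ℍ[ℝ]) 1) : pker 0 ξ = 1 := by
  simp [pker, mem_sphere_zero_iff_norm.1 hξ]

theorem continuousOn_pker :
    ContinuousOn (fun p : ℍ[ℝ] × ℍ[ℝ] => pker p.1 p.2) (ball 0 1 ×ˢ sphere 0 1) := by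
  simp_rw [pker]
  refine ContinuousOn.div (by fun_prop) (by fun_prop) fun p hp => ?_
  exact pow_ne_zero 4 (norm_ne_zero_iff.2 (sub_ne_zero_of_ball_sphere hp.1 hp.2))

theorem continuousOn_pker_right {z : ℍ[ℝ]} (hz : z ∈ ball (0 : ℍ[ℝ]) 1) :
    ContinuousOn (pker z) (sphere 0 1) :=
  continuousOn_pker.comp (f := fun ξ => (z, ξ)) (by fun_prop) fun _ hξ => ⟨hz, hξ⟩

theorem exists_unit_smul_eq (z : ℍ[ℝ]) : ∃ ζ : ℍ[ℝ], ‖ζ‖ = 1 ∧ z = ‖z‖ • ζ := by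
  rcases eq_or_ne z 0 with rfl | h0
  · exact ⟨1, norm_one, by simp⟩
  · exact ⟨‖z‖⁻¹ • z, norm_smul_inv_norm h0, by simp [smul_smul, h0]⟩

theorem integral_pker {ψ : Measure ℍ[ℝ]} [IsProbabilityMeasure ψ]
    (hS : ∀ᵐ ξ ∂ψ, ξ ∈ sphere (0 : ℍ[ℝ]) 1)
    (hψrot : ∀ T : ℍ[ℝ] ≃ₗᵢ[ℝ] ℍ[ℝ], ψ.map T = ψ) {z : ℍ[ℝ]} (hz : z ∈ ball (0 : ℍ[ℝ]) 1) :
    ∫ ξ, pker z ξ ∂ψ = 1 := by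
  obtain ⟨ζ, hζ, hzζ⟩ := exists_unit_smul_eq z
  have hζS : ζ ∈ sphere (0 : ℍ[ℝ]) 1 := mem_sphere_zero_iff_norm.2 hζ
  have hmean := spherical_mean_of_harmonic hS hψrot (contDiffOn_pker hζS)
    (fun x hx => laplacian_pker hx hζS) (a := 0) (t := ‖z‖) (by simpa using hz)
  rw [pker_zero hζS] at hmean
  rw [← hmean]
  refine integral_congr_ae ?_
  filter_upwards [hS] with ξ hξ
  rw [zero_add, hzζ, pker_smul_comm hζ (mem_sphere_zero_iff_norm.1 hξ), ← hzζ]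

theorem integral_inner_eq_zero {ψ : Measure ℍ[ℝ]}
    (hψrot : ∀ T : ℍ[ℝ] ≃ₗᵢ[ℝ] ℍ[ℝ], ψ.map T = ψ) (a : ℍ[ℝ]) :
    ∫ η, inner ℝ a η ∂ψ = 0 :=
  integral_eq_zero_of_odd hψrot _ fun ξ => inner_neg_right a ξ

/-- A maximum principle for functions with the spherical mean value property. -/
theorem nonpos_of_spherical_mean {ψ : Measure ℍ[ℝ]} [IsProbabilityMeasure ψ]
    (hS : ∀ᵐ ξ ∂ψ, ξ ∈ sphere (0 : ℍ[ℝ]) 1)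
    (hψrot : ∀ T : ℍ[ℝ] ≃ₗᵢ[ℝ] ℍ[ℝ], ψ.map T = ψ) {u : ℍ[ℝ] → ℝ}
    (hu : ContinuousOn u (ball 0 1))
    (hmean : ∀ (a : ℍ[ℝ]) (t : ℝ), ‖a‖ + |t| < 1 → ∫ η, u (a + t • η) ∂ψ = u a)
    (hbdry : ∀ ε > 0, ∃ ρ < 1, ∀ z ∈ ball (0 : ℍ[ℝ]) 1, ρ ≤ ‖z‖ → u z ≤ ε)
    {z : ℍ[ℝ]} (hz : z ∈ ball (0 : ℍ[ℝ]) 1) : u z ≤ 0 := by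
  refine le_of_forall_pos_le_add fun ε hε => ?_
  obtain ⟨ρ, hρ1, hρ⟩ := hbdry (ε / 2) (half_pos hε)
  set R := max ρ ‖z‖ with hR
  have hR1 : R < 1 := max_lt hρ1 (mem_ball_zero_iff.1 hz)
  have hzR : ‖z‖ ≤ R := le_max_right _ _
  have hball : closedBall (0 : ℍ[ℝ]) R ⊆ ball 0 1 := closedBall_subset_ball hR1
  obtain ⟨a, ha, hmax⟩ := (isCompact_closedBall (0 : ℍ[ℝ]) R).exists_isMaxOn
    ⟨z, mem_closedBall_zero_iff.2 hzR⟩ (f := fun w => u w + ε / 2 * ‖w‖ ^ 2)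
    ((hu.mono hball).add (by fun_prop))
  rw [mem_closedBall_zero_iff] at ha
  have haR : ‖a‖ = R := by
    by_contra hne
    have hlt : ‖a‖ < R := lt_of_le_of_ne ha hne
    have ht : 0 < R - ‖a‖ := sub_pos.2 hlt
    set t := R - ‖a‖ with htdef
    have hat : ‖a‖ + |t| < 1 := by rw [abs_of_pos ht]; linarith
    have hu' : ContinuousOn (fun η : ℍ[ℝ] => u (a + t • η)) (sphere 0 1) :=
      hu.comp (by fun_prop) fun η hη => add_smul_mem_ball hat hη
    have i1 := integrable_of_continuousOn_sphere hS hu'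
    have i2 : Integrable (fun η => ε * t * inner ℝ a η) ψ :=
      integrable_of_continuousOn_sphere hS (by fun_prop)
    have i3 : Integrable (fun _ : ℍ[ℝ] => ε / 2 * (‖a‖ ^ 2 + t ^ 2)) ψ := integrable_const _
    have i12 : Integrable (fun η => u (a + t • η) + ε * t * inner ℝ a η) ψ := i1.add i2
    have hle : ∫ η, (u (a + t • η) + ε * t * inner ℝ a η + ε / 2 * (‖a‖ ^ 2 + t ^ 2)) ∂ψ
        ≤ ∫ _, (u a + ε / 2 * ‖a‖ ^ 2) ∂ψ := by
      refine integral_mono_ae (i12.add i3) (integrable_const _) ?_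
      filter_upwards [hS] with η hη
      rw [mem_sphere_zero_iff_norm] at hη
      have hnorm : ‖a + t • η‖ ≤ R := by
        refine (norm_add_le _ _).trans ?_
        rw [norm_smul, hη, Real.norm_eq_abs, abs_of_pos ht]
        linarith
      have h := hmax (mem_closedBall_zero_iff.2 hnorm)
      simp only [Set.mem_ofPred_eq, norm_add_sq_real, norm_smul, hη, real_inner_smul_right,
        Real.norm_eq_abs, abs_of_pos ht] at h
      linarith
    rw [integral_add i12 i3, integral_add i1 i2, integral_const_mul,
      integral_inner_eq_zero hψrot, hmean a t hat, integral_const, integral_const] at hle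
    simp only [probReal_univ, one_smul, mul_zero, add_zero] at hle
    nlinarith [mul_pos hε (pow_pos ht 2)]
  have h1 := hmax (mem_closedBall_zero_iff.2 hzR)
  have h2 := hρ a (mem_ball_zero_iff.2 (haR ▸ hR1)) (haR ▸ le_max_left _ _)
  have h3 : ‖a‖ ^ 2 ≤ 1 := pow_le_one₀ (norm_nonneg a) (haR ▸ hR1.le)
  simp only [Set.mem_ofPred_eq] at h1
  nlinarith [mul_nonneg hε.le (sq_nonneg ‖z‖), mul_le_mul_of_nonneg_left h3 hε.le]

theorem continuousOn_integral_sphere {ψ : Measure ℍ[ℝ]} [IsProbabilityMeasure ψ]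
    (hS : ∀ᵐ ξ ∂ψ, ξ ∈ sphere (0 : ℍ[ℝ]) 1) {F : ℍ[ℝ] → ℍ[ℝ] → ℝ} {Ω : Set ℍ[ℝ]} (hΩ : IsOpen Ω)
    (hF : ContinuousOn (Function.uncurry F) (Ω ×ˢ sphere 0 1)) :
    ContinuousOn (fun z => ∫ ξ, F z ξ ∂ψ) Ω := by
  refine continuousOn_of_forall_continuousAt fun z hz => ?_
  obtain ⟨ε, hε, hεΩ⟩ := Metric.nhds_basis_closedBall.mem_iff.1 (hΩ.mem_nhds hz)
  obtain ⟨C, hC⟩ := ((isCompact_closedBall z ε).prod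
    (isCompact_sphere (0 : ℍ[ℝ]) 1)).exists_bound_of_continuousOn
    (hF.mono (Set.prod_mono hεΩ le_rfl))
  refine continuousAt_of_dominated (bound := fun _ => C) ?_ ?_ (integrable_const C) ?_
  · filter_upwards [hΩ.mem_nhds hz] with x hx
    exact (integrable_of_continuousOn_sphere hS
      (hF.comp (f := fun ξ => (x, ξ)) (by fun_prop) fun ξ hξ => ⟨hx, hξ⟩)).aestronglyMeasurable
  · filter_upwards [closedBall_mem_nhds z hε] with x hx
    filter_upwards [hS] with ξ hξ using hC (x, ξ) ⟨hx, hξ⟩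
  · filter_upwards [hS] with ξ hξ
    exact (hF.comp (f := fun x => (x, ξ)) (by fun_prop) fun x hx => ⟨hx, hξ⟩).continuousAt
      (hΩ.mem_nhds hz)

theorem integral_integral_swap_sphere {ψ : Measure ℍ[ℝ]} [IsProbabilityMeasure ψ]
    (hS : ∀ᵐ ξ ∂ψ, ξ ∈ sphere (0 : ℍ[ℝ]) 1) {F : ℍ[ℝ] → ℍ[ℝ] → ℝ}
    (hF : ContinuousOn (Function.uncurry F) (sphere 0 1 ×ˢ sphere 0 1)) :
    ∫ η, ∫ ξ, F η ξ ∂ψ ∂ψ = ∫ ξ, ∫ η, F η ξ ∂ψ ∂ψ := by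
  refine integral_integral_swap ?_
  have h := hF.integrableOn_compact (μ := ψ.prod ψ) ((isCompact_sphere 0 1).prod
    (isCompact_sphere 0 1))
  rwa [IntegrableOn, ← Measure.prod_restrict, restrict_sphere hS] at h

theorem continuousOn_mul_pker {g : ℍ[ℝ] → ℝ} (hg : ContinuousOn g (sphere 0 1)) :
    ContinuousOn (Function.uncurry fun z ξ => g ξ * pker z ξ) (ball 0 1 ×ˢ sphere 0 1) :=
  (hg.comp continuousOn_snd fun _ hp => hp.2).mul continuousOn_pker

theorem integrable_mul_pker {ψ : Measure ℍ[ℝ]} [IsProbabilityMeasure ψ]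
    (hS : ∀ᵐ ξ ∂ψ, ξ ∈ sphere (0 : ℍ[ℝ]) 1) {g : ℍ[ℝ] → ℝ} (hg : ContinuousOn g (sphere 0 1))
    {z : ℍ[ℝ]} (hz : z ∈ ball (0 : ℍ[ℝ]) 1) : Integrable (fun ξ => g ξ * pker z ξ) ψ :=
  integrable_of_continuousOn_sphere hS (hg.mul (continuousOn_pker_right hz))

/-- Poisson integrals have the spherical mean value property. -/
theorem spherical_mean_poisson_integral {ψ : Measure ℍ[ℝ]} [IsProbabilityMeasure ψ]
    (hS : ∀ᵐ ξ ∂ψ, ξ ∈ sphere (0 : ℍ[ℝ]) 1)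
    (hψrot : ∀ T : ℍ[ℝ] ≃ₗᵢ[ℝ] ℍ[ℝ], ψ.map T = ψ) {g : ℍ[ℝ] → ℝ}
    (hg : ContinuousOn g (sphere 0 1)) {a : ℍ[ℝ]} {t : ℝ} (hat : ‖a‖ + |t| < 1) :
    ∫ η, ∫ ξ, g ξ * pker (a + t • η) ξ ∂ψ ∂ψ = ∫ ξ, g ξ * pker a ξ ∂ψ := by
  have hF : ContinuousOn (Function.uncurry fun η ξ => g ξ * pker (a + t • η) ξ)
      (sphere 0 1 ×ˢ sphere 0 1) :=
    (continuousOn_mul_pker hg).comp (f := fun p : ℍ[ℝ] × ℍ[ℝ] => (a + t • p.1, p.2))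
      (by fun_prop) fun p hp => ⟨add_smul_mem_ball hat hp.1, hp.2⟩
  rw [integral_integral_swap_sphere hS hF]
  refine integral_congr_ae ?_
  filter_upwards [hS] with ξ hξ
  rw [integral_const_mul, spherical_mean_of_harmonic hS hψrot (contDiffOn_pker hξ)
    (fun x hx => laplacian_pker hx hξ) hat]

/-- The Poisson integral of the boundary values of `g` approaches `g` uniformly at the boundary. -/
theorem abs_sub_poisson_integral_le {ψ : Measure ℍ[ℝ]} [IsProbabilityMeasure ψ]
    (hS : ∀ᵐ ξ ∂ψ, ξ ∈ sphere (0 : ℍ[ℝ]) 1)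
    (hψrot : ∀ T : ℍ[ℝ] ≃ₗᵢ[ℝ] ℍ[ℝ], ψ.map T = ψ) {g : ℍ[ℝ] → ℝ}
    (hg : ContinuousOn g (closedBall 0 1)) {ε : ℝ} (hε : 0 < ε) :
    ∃ ρ < 1, ∀ z ∈ ball (0 : ℍ[ℝ]) 1, ρ ≤ ‖z‖ → |g z - ∫ ξ, g ξ * pker z ξ ∂ψ| ≤ ε := by
  obtain ⟨δ, hδ, hunif⟩ := Metric.uniformContinuousOn_iff.1
    ((isCompact_closedBall (0 : ℍ[ℝ]) 1).uniformContinuousOn_of_continuous hg) (ε / 2)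
    (half_pos hε)
  obtain ⟨M, hM⟩ := (isCompact_closedBall (0 : ℍ[ℝ]) 1).exists_bound_of_continuousOn hg
  have hM0 : 0 ≤ M := (norm_nonneg _).trans (hM 0 (by simp))
  have hgS : ContinuousOn g (sphere 0 1) := hg.mono sphere_subset_closedBall
  set κ := ε * δ ^ 4 / (8 * (M + 1)) with hκ
  have hκ0 : 0 < κ := by positivity
  refine ⟨1 - κ, by linarith, fun z hz hρ => ?_⟩
  have hzc := ball_subset_closedBall hz
  have hz1 := mem_ball_zero_iff.1 hz
  have hP := integrable_of_continuousOn_sphere hS (continuousOn_pker_right hz)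
  have hgP := integrable_mul_pker hS hgS hz
  have hrep : g z - ∫ ξ, g ξ * pker z ξ ∂ψ = ∫ ξ, (g z - g ξ) * pker z ξ ∂ψ := by
    simp_rw [sub_mul]
    rw [integral_sub (hP.const_mul _) hgP, integral_const_mul, integral_pker hS hψrot hz, mul_one]
  have hconst : (1 - ‖z‖ ^ 2) / δ ^ 4 * (2 * M) ≤ ε / 2 := by
    have h1 : 1 - ‖z‖ ^ 2 ≤ 2 * κ := by nlinarith [norm_nonneg z]
    calc (1 - ‖z‖ ^ 2) / δ ^ 4 * (2 * M) ≤ 2 * κ / δ ^ 4 * (2 * M) := by gcongr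
      _ = ε / 2 * (M / (M + 1)) := by rw [hκ]; field_simp; ring
      _ ≤ ε / 2 * 1 := by
        gcongr
        rw [div_le_one (by linarith)]
        linarith
      _ = ε / 2 := mul_one _
  rw [hrep, ← Real.norm_eq_abs]
  calc ‖∫ ξ, (g z - g ξ) * pker z ξ ∂ψ‖ ≤ ∫ ξ, (ε / 2 * pker z ξ + ε / 2) ∂ψ := by
        refine norm_integral_le_of_norm_le ((hP.const_mul _).add (integrable_const _)) ?_
        filter_upwards [hS] with ξ hξ
        have hP0 := pker_nonneg (ξ := ξ) hz
        rw [norm_mul, Real.norm_of_nonneg hP0]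
        have hξc := sphere_subset_closedBall hξ
        rcases lt_or_ge (dist z ξ) δ with hlt | hge
        · have h := hunif z hzc ξ hξc hlt
          rw [dist_eq_norm] at h
          have := mul_le_mul_of_nonneg_right h.le hP0
          linarith
        · have h1 : ‖g z - g ξ‖ ≤ 2 * M := by
            linarith [norm_sub_le (g z) (g ξ), hM z hzc, hM ξ hξc]
          have h2 : pker z ξ ≤ (1 - ‖z‖ ^ 2) / δ ^ 4 := by
            rw [dist_eq_norm] at hge
            have : 0 ≤ 1 - ‖z‖ ^ 2 := sub_nonneg.2 (pow_le_one₀ (norm_nonneg z) hz1.le)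
            unfold pker
            gcongr
          have h3 : ‖g z - g ξ‖ * pker z ξ ≤ 2 * M * ((1 - ‖z‖ ^ 2) / δ ^ 4) := by gcongr
          have h4 : 0 ≤ ε / 2 * pker z ξ := by positivity
          linarith
    _ = ε := by
        rw [integral_add (hP.const_mul _) (integrable_const _), integral_const_mul,
          integral_pker hS hψrot hz, integral_const]
        simp

/-- Poisson's formula for continuous functions with the spherical mean value property. -/
theorem eq_poisson_integral {ψ : Measure ℍ[ℝ]} [IsProbabilityMeasure ψ]
    (hS : ∀ᵐ ξ ∂ψ, ξ ∈ sphere (0 : ℍ[ℝ]) 1)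
    (hψrot : ∀ T : ℍ[ℝ] ≃ₗᵢ[ℝ] ℍ[ℝ], ψ.map T = ψ) {g : ℍ[ℝ] → ℝ}
    (hg : ContinuousOn g (closedBall 0 1))
    (hmean : ∀ (a : ℍ[ℝ]) (t : ℝ), ‖a‖ + |t| < 1 → ∫ η, g (a + t • η) ∂ψ = g a)
    {z : ℍ[ℝ]} (hz : z ∈ ball (0 : ℍ[ℝ]) 1) : g z = ∫ ξ, g ξ * pker z ξ ∂ψ := by
  have hgS : ContinuousOn g (sphere 0 1) := hg.mono sphere_subset_closedBall
  have hgB : ContinuousOn g (ball 0 1) := hg.mono ball_subset_closedBall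
  set h : ℍ[ℝ] → ℝ := fun z => ∫ ξ, g ξ * pker z ξ ∂ψ with hh
  have hhB : ContinuousOn h (ball 0 1) :=
    continuousOn_integral_sphere hS isOpen_ball (continuousOn_mul_pker hgS)
  have hhmean : ∀ (a : ℍ[ℝ]) (t : ℝ), ‖a‖ + |t| < 1 → ∫ η, h (a + t • η) ∂ψ = h a :=
    fun a t hat => spherical_mean_poisson_integral hS hψrot hgS hat
  have hint : ∀ {u : ℍ[ℝ] → ℝ}, ContinuousOn u (ball 0 1) → ∀ {a : ℍ[ℝ]} {t : ℝ},
      ‖a‖ + |t| < 1 → Integrable (fun η => u (a + t • η)) ψ := fun hu _ _ hat =>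
    integrable_of_continuousOn_sphere hS (hu.comp (by fun_prop)
      fun η hη => add_smul_mem_ball hat hη)
  refine le_antisymm (sub_nonpos.1 ?_) (sub_nonpos.1 ?_)
  · refine nonpos_of_spherical_mean hS hψrot (u := fun z => g z - h z) (hgB.sub hhB)
      (fun a t hat => ?_) (fun ε hε => ?_) hz
    · rw [integral_sub (hint hgB hat) (hint hhB hat), hmean a t hat, hhmean a t hat]
    · obtain ⟨ρ, hρ1, hρ⟩ := abs_sub_poisson_integral_le hS hψrot hg hε
      exact ⟨ρ, hρ1, fun z hz hzρ => (abs_le.1 (hρ z hz hzρ)).2⟩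
  · refine nonpos_of_spherical_mean hS hψrot (u := fun z => h z - g z) (hhB.sub hgB)
      (fun a t hat => ?_) (fun ε hε => ?_) hz
    · rw [integral_sub (hint hhB hat) (hint hgB hat), hmean a t hat, hhmean a t hat]
    · obtain ⟨ρ, hρ1, hρ⟩ := abs_sub_poisson_integral_le hS hψrot hg hε
      refine ⟨ρ, hρ1, fun z hz hzρ => ?_⟩
      have := (abs_le.1 (hρ z hz hzρ)).1
      linarith

theorem measurable_bdrySign : Measurable bdrySign := by
  have hre : Measurable fun ξ : ℍ[ℝ] => ξ.re := Quaternion.continuous_re.measurable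
  unfold bdrySign Real.sign
  exact Measurable.ite (measurableSet_lt hre measurable_const) measurable_const
    (Measurable.ite (measurableSet_lt measurable_const hre) measurable_const measurable_const)

theorem norm_bdrySign_le (ξ : ℍ[ℝ]) : ‖bdrySign ξ‖ ≤ 1 := by
  rcases Real.sign_apply_eq ξ.re with h | h | h <;> simp [bdrySign, h]

theorem integral_bdrySign {ψ : Measure ℍ[ℝ]}
    (hψrot : ∀ T : ℍ[ℝ] ≃ₗᵢ[ℝ] ℍ[ℝ], ψ.map T = ψ) : ∫ ξ, bdrySign ξ ∂ψ = 0 :=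
  integral_eq_zero_of_odd hψrot _ fun ξ => by simp [bdrySign, Real.sign_neg]

/-- On the positive real axis, `pker r ξ - (1 - r²) / (1 + r²)²` has the sign of `ξ.re`. -/
theorem abs_pker_coe_sub {r : ℝ} (hr0 : 0 ≤ r) (hr1 : r < 1) {ξ : ℍ[ℝ]}
    (hξ : ξ ∈ sphere (0 : ℍ[ℝ]) 1) :
    |pker r ξ - (1 - r ^ 2) / (1 + r ^ 2) ^ 2|
      = bdrySign ξ * (pker r ξ - (1 - r ^ 2) / (1 + r ^ 2) ^ 2) := by
  have hnr : ‖(r : ℍ[ℝ])‖ = r := by rw [Quaternion.norm_coe, Real.norm_of_nonneg hr0]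
  have hrB : (r : ℍ[ℝ]) ∈ ball (0 : ℍ[ℝ]) 1 := by rwa [mem_ball_zero_iff, hnr]
  have hd : ‖(r : ℍ[ℝ]) - ξ‖ ^ 2 = 1 + r ^ 2 - 2 * (r * ξ.re) := by
    rw [norm_sub_sq_real, hnr, mem_sphere_zero_iff_norm.1 hξ, inner_eq_coords]
    simp
    ring
  have hd0 : 0 < ‖(r : ℍ[ℝ]) - ξ‖ ^ 2 :=
    pow_pos (norm_pos_iff.2 (sub_ne_zero_of_ball_sphere hrB hξ)) 2
  rw [hd] at hd0
  have hr2 : 0 ≤ 1 - r ^ 2 := sub_nonneg.2 (pow_le_one₀ hr0 hr1.le)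
  rw [pker_eq, hd, hnr, bdrySign]
  rcases lt_trichotomy ξ.re 0 with h | h | h
  · have hx : r * ξ.re ≤ 0 := mul_nonpos_of_nonneg_of_nonpos hr0 h.le
    rw [Real.sign_of_neg h, abs_of_nonpos, neg_one_mul]
    rw [sub_nonpos]
    gcongr
    linarith
  · simp [h]
  · have hx : 0 ≤ r * ξ.re := mul_nonneg hr0 h.le
    rw [Real.sign_of_pos h, abs_of_nonneg, one_mul]
    rw [sub_nonneg]
    gcongr
    linarith

theorem integral_abs_pker_sub {ψ : Measure ℍ[ℝ]} [IsProbabilityMeasure ψ]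
    (hS : ∀ᵐ ξ ∂ψ, ξ ∈ sphere (0 : ℍ[ℝ]) 1)
    (hψrot : ∀ T : ℍ[ℝ] ≃ₗᵢ[ℝ] ℍ[ℝ], ψ.map T = ψ) {z : ℍ[ℝ]} (hz : z ∈ ball (0 : ℍ[ℝ]) 1) :
    ∫ ξ, |pker z ξ - (1 - ‖z‖ ^ 2) / (1 + ‖z‖ ^ 2) ^ 2| ∂ψ = Upois ψ ((‖z‖ : ℝ) : ℍ[ℝ]) := by
  obtain ⟨u, hu, hzu⟩ := exists_unit_smul_eq z
  set r := ‖z‖ with hr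
  set c := (1 - r ^ 2) / (1 + r ^ 2) ^ 2
  have hr1 : r < 1 := mem_ball_zero_iff.1 hz
  have hr0 : 0 ≤ r := norm_nonneg z
  have hnr : ‖(r : ℍ[ℝ])‖ = r := by rw [Quaternion.norm_coe, Real.norm_of_nonneg hr0]
  have hrB : (r : ℍ[ℝ]) ∈ ball (0 : ℍ[ℝ]) 1 := by rwa [mem_ball_zero_iff, hnr]
  have hT : mulLeftIsometry u hu (r : ℍ[ℝ]) = z := by
    rw [mulLeftIsometry_apply, Quaternion.mul_coe_eq_smul, ← hzu]
  have hP : ∀ ξ, pker z (mulLeftIsometry u hu ξ) = pker r ξ := fun ξ => by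
    rw [← hT, pker, pker, ← map_sub, LinearIsometryEquiv.norm_map, LinearIsometryEquiv.norm_map]
  have hsig : Integrable bdrySign ψ :=
    Integrable.of_bound measurable_bdrySign.aestronglyMeasurable 1
      (Filter.Eventually.of_forall norm_bdrySign_le)
  have hsP : Integrable (fun ξ => bdrySign ξ * pker r ξ) ψ :=
    (integrable_of_continuousOn_sphere hS (continuousOn_pker_right hrB)).bdd_mul
      measurable_bdrySign.aestronglyMeasurable (Filter.Eventually.of_forall norm_bdrySign_le)
  rw [← integral_comp_isometry hψrot (mulLeftIsometry u hu)]
  simp_rw [hP]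
  calc ∫ ξ, |pker r ξ - c| ∂ψ = ∫ ξ, (bdrySign ξ * pker r ξ - bdrySign ξ * c) ∂ψ := by
        refine integral_congr_ae ?_
        filter_upwards [hS] with ξ hξ
        rw [abs_pker_coe_sub hr0 hr1 hξ, mul_sub]
    _ = Upois ψ (r : ℍ[ℝ]) := by
        rw [integral_sub hsP (hsig.mul_const c), integral_mul_const, integral_bdrySign hψrot,
          zero_mul, sub_zero, Upois]

theorem le_Upois_of_spherical_mean {ψ : Measure ℍ[ℝ]} [IsProbabilityMeasure ψ]
    (hS : ∀ᵐ ξ ∂ψ, ξ ∈ sphere (0 : ℍ[ℝ]) 1)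
    (hψrot : ∀ T : ℍ[ℝ] ≃ₗᵢ[ℝ] ℍ[ℝ], ψ.map T = ψ) {g : ℍ[ℝ] → ℝ}
    (hg : ContinuousOn g (closedBall 0 1))
    (hmean : ∀ (a : ℍ[ℝ]) (t : ℝ), ‖a‖ + |t| < 1 → ∫ η, g (a + t • η) ∂ψ = g a)
    (hg0 : g 0 = 0) (hbd : ∀ ξ ∈ sphere (0 : ℍ[ℝ]) 1, |g ξ| ≤ 1)
    {z : ℍ[ℝ]} (hz : z ∈ ball (0 : ℍ[ℝ]) 1) : g z ≤ Upois ψ ((‖z‖ : ℝ) : ℍ[ℝ]) := by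
  have hgS : ContinuousOn g (sphere 0 1) := hg.mono sphere_subset_closedBall
  have hzero : ∫ ξ, g ξ ∂ψ = 0 := by
    rw [← hg0, eq_poisson_integral hS hψrot hg hmean (mem_ball_self one_pos)]
    refine integral_congr_ae ?_
    filter_upwards [hS] with ξ hξ
    rw [pker_zero hξ, mul_one]
  rw [← integral_abs_pker_sub hS hψrot hz]
  set c := (1 - ‖z‖ ^ 2) / (1 + ‖z‖ ^ 2) ^ 2
  have hgP := integrable_mul_pker hS hgS hz
  have hgc := (integrable_of_continuousOn_sphere hS hgS).mul_const c
  have hP := continuousOn_pker_right hz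
  calc g z = ∫ ξ, (g ξ * pker z ξ - g ξ * c) ∂ψ := by
        rw [integral_sub hgP hgc, integral_mul_const, hzero, zero_mul, sub_zero,
          ← eq_poisson_integral hS hψrot hg hmean hz]
    _ ≤ ∫ ξ, |pker z ξ - c| ∂ψ := by
        refine integral_mono_ae (hgP.sub hgc)
          (integrable_of_continuousOn_sphere hS (hP.sub continuousOn_const).abs) ?_
        filter_upwards [hS] with ξ hξ
        rw [← mul_sub]
        refine (le_abs_self _).trans ?_
        rw [abs_mul]
        exact mul_le_of_le_one_left (abs_nonneg _) (hbd ξ hξ)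

theorem le_Upois_of_harmonic {ψ : Measure ℍ[ℝ]} [IsProbabilityMeasure ψ]
    (hS : ∀ᵐ ξ ∂ψ, ξ ∈ sphere (0 : ℍ[ℝ]) 1)
    (hψrot : ∀ T : ℍ[ℝ] ≃ₗᵢ[ℝ] ℍ[ℝ], ψ.map T = ψ) {g : ℍ[ℝ] → ℝ}
    (hg : ContDiffOn ℝ 2 g (ball 0 1))
    (hΔ : ∀ x ∈ ball (0 : ℍ[ℝ]) 1, Laplacian.laplacian g x = 0)
    (hg0 : g 0 = 0) (hbd : ∀ x ∈ ball (0 : ℍ[ℝ]) 1, |g x| ≤ 1)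
    {z : ℍ[ℝ]} (hz : z ∈ ball (0 : ℍ[ℝ]) 1) : g z ≤ Upois ψ ((‖z‖ : ℝ) : ℍ[ℝ]) := by
  have hball : ∀ ρ ∈ Set.Ioo (0 : ℝ) 1, ∀ w ∈ closedBall (0 : ℍ[ℝ]) 1,
      ρ • w ∈ ball (0 : ℍ[ℝ]) 1 := by
    intro ρ hρ w hw
    rw [mem_closedBall_zero_iff] at hw
    rw [mem_ball_zero_iff, norm_smul, Real.norm_of_nonneg hρ.1.le]
    exact (mul_le_of_le_one_right hρ.1.le hw).trans_lt hρ.2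
  have hscale : ∀ ρ ∈ Set.Ioo (0 : ℝ) 1, g (ρ • z) ≤ Upois ψ ((‖z‖ : ℝ) : ℍ[ℝ]) := by
    intro ρ hρ
    refine le_Upois_of_spherical_mean hS hψrot (g := fun w => g (ρ • w))
      (hg.continuousOn.comp (by fun_prop) (hball ρ hρ)) (fun a t hat => ?_) (by simpa using hg0)
      (fun ξ hξ => hbd _ (hball ρ hρ ξ (sphere_subset_closedBall hξ))) hz
    simp_rw [smul_add, smul_smul]
    refine spherical_mean_of_harmonic hS hψrot hg hΔ ?_
    rw [norm_smul, abs_mul, Real.norm_eq_abs, abs_of_pos hρ.1, ← mul_add]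
    exact (mul_le_of_le_one_left (by positivity) hρ.2.le).trans_lt hat
  have hlim : Filter.Tendsto (fun ρ : ℝ => g (ρ • z)) (nhdsWithin 1 (Set.Iio 1)) (nhds (g z)) := by
    have hgz : ContinuousAt g ((1 : ℝ) • z) := by
      rw [one_smul]
      exact hg.continuousOn.continuousAt (isOpen_ball.mem_nhds hz)
    have h := hgz.comp (f := fun ρ : ℝ => ρ • z) (by fun_prop)
    have h' := h.tendsto.mono_left (nhdsWithin_le_nhds (s := Set.Iio 1))
    simpa [Function.comp_def] using h'
  refine le_of_tendsto hlim ?_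
  filter_upwards [Ioo_mem_nhdsLT (zero_lt_one (α := ℝ))] with ρ hρ using hscale ρ hρ

theorem qLap_eq_laplacian {f : ℍ[ℝ] → ℍ[ℝ]} {z : ℍ[ℝ]} (hf : ContDiffAt ℝ 2 f z) :
    qLap f z = Laplacian.laplacian f z := by
  have hd : DifferentiableAt ℝ (fderiv ℝ f) z :=
    (hf.fderiv_right (m := 1) (by norm_num)).differentiableAt (by norm_num)
  rw [InnerProductSpace.laplacian_eq_iteratedFDeriv_orthonormalBasis f
    (rotatedBasis 1 norm_one)]
  simp only [iteratedFDeriv_two_apply, rotatedBasis_apply, mul_one]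
  refine Finset.sum_congr rfl fun j _ => ?_
  rw [fderiv_clm_apply hd (differentiableAt_const _)]
  simp

/-- The sharp bound `|f(z)| ≤ U(|z|·1)` for harmonic `f : B → ℍ` with `f(0) = 0`
and `|f| ≤ 1`; here `ψ` is the rotation-invariant probability measure on `S³`. -/
theorem harmonic_schwarz_bound
    (ψ : Measure ℍ[ℝ]) (hψone : ψ (sphere (0 : ℍ[ℝ]) 1) = 1)
    (hψsupp : ψ (sphere (0 : ℍ[ℝ]) 1)ᶜ = 0)
    (hψrot : ∀ T : ℍ[ℝ] ≃ₗᵢ[ℝ] ℍ[ℝ], ψ.map T = ψ)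
    (f : ℍ[ℝ] → ℍ[ℝ]) (hf : ContDiffOn ℝ 2 f (ball 0 1))
    (hharm : ∀ z ∈ ball (0 : ℍ[ℝ]) 1, qLap f z = 0)
    (hf0 : f 0 = 0) (hbd : ∀ z ∈ ball (0 : ℍ[ℝ]) 1, ‖f z‖ ≤ 1) :
    ∀ z ∈ ball (0 : ℍ[ℝ]) 1, ‖f z‖ ≤ Upois ψ ((‖z‖ : ℝ) : ℍ[ℝ]) := by
  intro z hz
  have hS := ae_mem_sphere hψsupp
  have : IsProbabilityMeasure ψ := ⟨by
    rw [← measure_add_measure_compl isClosed_sphere.measurableSet, hψone, hψsupp, add_zero]⟩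
  set v : ℍ[ℝ] := ‖f z‖⁻¹ • f z with hv
  have hv1 : ‖v‖ ≤ 1 := by
    rw [hv, norm_smul, norm_inv, norm_norm]
    exact inv_mul_le_one
  have hfz : inner ℝ v (f z) = ‖f z‖ := by
    rw [hv, real_inner_smul_left, real_inner_self_eq_norm_sq]
    rcases eq_or_ne ‖f z‖ 0 with h | h
    · simp [h]
    · field_simp
  rw [← hfz]
  refine le_Upois_of_harmonic hS hψrot (g := fun w => inner ℝ v (f w))
    (contDiffOn_const.inner ℝ hf) (fun x hx => ?_) (by simp [hf0]) (fun x hx => ?_) hz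
  · have hfx : ContDiffAt ℝ 2 f x := hf.contDiffAt (isOpen_ball.mem_nhds hx)
    have h := hfx.laplacian_CLM_comp_left (l := innerSL ℝ v)
    rw [Function.comp_def] at h
    simp only [innerSL_apply_apply] at h
    rw [h, Function.comp_apply, ← qLap_eq_laplacian hfx, hharm x hx, map_zero]
  · exact (abs_real_inner_le_norm v (f x)).trans (mul_le_one₀ hv1 (norm_nonneg _) (hbd x hx))
end
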